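/- Let A be an Artin algebra, D ⊆ mod A a 0-Igusa-Todorov subcategory, and C_1, C_2 two D-syzygy finite subcategories. Let E ⊆ mod A be a subcategory such that every M ∈ E fits in a short exact sequence 0 → C_1 → M → C_2 → 0 with C_i ∈ C_i for i = 1, 2. Then E is (n, V, D)-LIT for some positive integer n and some module V. -/

import Mathlib

/-!
Common framework for formalizing "On Lat-Igusa-Todorov algebras" (Barrios–Mata).

For a ring `S`, `FGMod S` is the "category" of finitely generated (left) `S`-modules;
for an Artin algebra `A`, the category `mod A` of finitely generated *right*
`A`-modules is `FGMod Aᵐᵒᵖ`.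
-/

universe u v

open Function

namespace LIT

/-- The `η` invariant from Fitting's Lemma: for an endomorphism `L` of an abelian
group `G` and a subgroup `X`, the least `k` such that for all `m ≥ k` the
restriction of `L` to `L^m(X)` is a monomorphism `L^m(X) → L^{m+1}(X)`. -/
noncomputable def eta {G : Type v} [AddCommGroup G] (L : AddMonoid.End G)
    (X : AddSubgroup G) : ℕ :=
  sInf {k : ℕ | ∀ m : ℕ, k ≤ m → Set.InjOn L (X.map (L ^ m) : Set G)}

/-- Bundled finitely generated `S`-modules. -/
structure FGMod (S : Type u) [Ring S] : Type (u + 1) where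
  carrier : Type u
  [isAddCommGroup : AddCommGroup carrier]
  [isModule : Module S carrier]
  [isFinite : Module.Finite S carrier]

attribute [instance] FGMod.isAddCommGroup FGMod.isModule FGMod.isFinite

/-- The regular module `S` over itself. -/
def FGMod.regular (S : Type u) [Ring S] : FGMod S := ⟨S⟩

/-- A ring is finitely generated as a right module over itself. -/
instance (A : Type u) [Ring A] : Module.Finite Aᵐᵒᵖ A :=
  Module.Finite.of_surjective
    ({ toFun := MulOpposite.unop
       map_add' := fun _ _ => rfl
       map_smul' := fun _ _ => rfl } : Aᵐᵒᵖ →ₗ[Aᵐᵒᵖ] A)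
    (fun x => ⟨MulOpposite.op x, rfl⟩)

namespace FGMod

variable {S : Type u} [Ring S]

/-- Projectivity of a module. -/
def IsProj (M : FGMod S) : Prop := Module.Projective S M.carrier

/-- Direct sum (product) of two modules. -/
def prodMod (M N : FGMod S) : FGMod S := ⟨M.carrier × N.carrier⟩

/-- Finite direct sums. -/
def dsum {n : ℕ} (f : Fin n → FGMod S) : FGMod S := ⟨∀ i, (f i).carrier⟩

/-- `N` is a direct summand of `M`. -/
def IsSummand (N M : FGMod S) : Prop :=
  ∃ N' : FGMod S, Nonempty (M.carrier ≃ₗ[S] N.carrier × N'.carrier)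

/-- `addOf C` is `add C`: all direct summands of finite direct sums of modules of `C`. -/
def addOf (C : Set (FGMod S)) : Set (FGMod S) :=
  {N | ∃ (n : ℕ) (f : Fin n → FGMod S), (∀ i, f i ∈ C) ∧ IsSummand N (dsum f)}

/-- `f : P → M` is a projective cover: `P` projective, `f` surjective with superfluous kernel. -/
def IsProjCover {P M : FGMod S} (f : P.carrier →ₗ[S] M.carrier) : Prop :=
  P.IsProj ∧ Surjective f ∧
    ∀ N : Submodule S P.carrier, N ⊔ LinearMap.ker f = ⊤ → N = ⊤

/-- `N` is (isomorphic to) the syzygy `Ω(M)`, i.e. the kernel of a projective cover of `M`. -/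
def IsSyzygyOf (N M : FGMod S) : Prop :=
  ∃ (P : FGMod S) (f : P.carrier →ₗ[S] M.carrier),
    IsProjCover f ∧ Nonempty (N.carrier ≃ₗ[S] LinearMap.ker f)

/-- The syzygy `Ω(M)` of `M` (a choice of it; over an Artin algebra it exists and is
unique up to isomorphism). -/
noncomputable def syz (M : FGMod S) : FGMod S :=
  letI := Classical.propDecidable (∃ N, IsSyzygyOf N M)
  if h : ∃ N, IsSyzygyOf N M then h.choose else M

/-- `SES X Y Z` : there is a short exact sequence `0 → X → Y → Z → 0`. -/
def SES (X Y Z : FGMod S) : Prop :=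
  ∃ (f : X.carrier →ₗ[S] Y.carrier) (g : Y.carrier →ₗ[S] Z.carrier),
    Injective f ∧ Surjective g ∧ LinearMap.range f = LinearMap.ker g

/-- Projective dimension, via vanishing of syzygies. -/
noncomputable def pdim (M : FGMod S) : ℕ∞ :=
  sInf ((↑) '' {n : ℕ | (syz^[n] M).IsProj})

end FGMod

open FGMod

variable {S : Type u} [Ring S]

/-- The finitistic dimension of a class of modules: the supremum of the projective
dimensions of its modules of finite projective dimension. -/
noncomputable def findim (C : Set (FGMod S)) : ℕ∞ :=
  ⨆ M ∈ {M ∈ C | pdim M ≠ ⊤}, pdim M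

/-- The global dimension of a class of modules. -/
noncomputable def gldim (C : Set (FGMod S)) : ℕ∞ :=
  ⨆ M ∈ C, pdim M

/-- The defining relations of `K₀`: `[M] - [M'] - [M'']` for `M ≅ M' ⊕ M''`, and `[P]`
for `P` projective. -/
def K0Rels (S : Type u) [Ring S] : AddSubgroup (FreeAbelianGroup (FGMod S)) :=
  AddSubgroup.closure
    ({x | ∃ M M' M'' : FGMod S,
        Nonempty (M.carrier ≃ₗ[S] M'.carrier × M''.carrier) ∧
        x = FreeAbelianGroup.of M - FreeAbelianGroup.of M' - FreeAbelianGroup.of M''} ∪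
      {x | ∃ P : FGMod S, P.IsProj ∧ x = FreeAbelianGroup.of P})

/-- `K₀(A)`: the free abelian group on the modules modulo the relations above. -/
abbrev K0 (S : Type u) [Ring S] : Type (u + 1) :=
  FreeAbelianGroup (FGMod S) ⧸ K0Rels S

/-- The class `[M]` of a module in `K₀`. -/
def toK0 (M : FGMod S) : K0 S := QuotientAddGroup.mk (FreeAbelianGroup.of M)

/-- `⟨C⟩`: the subgroup of `K₀` generated by the classes of direct summands of
modules of `C`. -/
def grpOf (C : Set (FGMod S)) : AddSubgroup (K0 S) :=
  AddSubgroup.closure {x | ∃ N M : FGMod S, M ∈ C ∧ IsSummand N M ∧ x = toK0 N}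

/-- `K_D = K₀/⟨D⟩`. -/
abbrev KD (D : Set (FGMod S)) : Type (u + 1) := K0 S ⧸ grpOf D

/-- The class of a module in `K_D`. -/
def toKD (D : Set (FGMod S)) (M : FGMod S) : KD D :=
  QuotientAddGroup.mk (toK0 M)

/-- `L` is the endomorphism `Ω̄` of `K₀` induced by the syzygy operator (it is unique). -/
def IsSyzEnd (L : AddMonoid.End (K0 S)) : Prop :=
  ∀ M : FGMod S, L (toK0 M) = toK0 (syz M)

/-- `L` is the endomorphism `Ω̄_D` of `K_D` induced by the syzygy operator. -/
def IsSyzEndD (D : Set (FGMod S)) (L : AddMonoid.End (KD D)) : Prop :=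
  ∀ M : FGMod S, L (toKD D M) = toKD D (syz M)

/-- The Igusa–Todorov function `φ`, relative to the induced endomorphism `L = Ω̄` of `K₀`. -/
noncomputable def phi (L : AddMonoid.End (K0 S)) (M : FGMod S) : ℕ :=
  eta L (grpOf {M})

/-- `φ`-dimension of a class of modules. -/
noncomputable def phidim (L : AddMonoid.End (K0 S)) (C : Set (FGMod S)) : ℕ∞ :=
  ⨆ M ∈ C, (phi L M : ℕ∞)

/-- The generalized Igusa–Todorov function `φ_[D]`, relative to `L = Ω̄_D`. -/
noncomputable def phiD (D : Set (FGMod S)) (L : AddMonoid.End (KD D)) (M : FGMod S) : ℕ :=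
  eta L ((grpOf {M}).map (QuotientAddGroup.mk' (grpOf D)))

/-- The generalized Igusa–Todorov function `ψ_[D]`. -/
noncomputable def psiD (D : Set (FGMod S)) (L : AddMonoid.End (KD D)) (M : FGMod S) : ℕ∞ :=
  (phiD D L M : ℕ∞) + findim (addOf {syz^[phiD D L M] M})

/-- `D` is a `0`-Igusa–Todorov subcategory: `D = add D`, `Ω(D) ⊆ D` and `φdim D = 0`. -/
def IsZeroIT (L : AddMonoid.End (K0 S)) (D : Set (FGMod S)) : Prop :=
  D = addOf D ∧ (∀ M ∈ D, syz M ∈ D) ∧ phidim L D = 0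

/-- The class `C` is `(n,V,D)`-Lat-Igusa-Todorov: every `M ∈ C` admits an exact sequence
`0 → V₁ ⊕ D₁ → V₀ ⊕ D₀ → Ωⁿ(M) → 0` with `V₁, V₀ ∈ add V` and `D₁, D₀ ∈ D`. -/
def IsLITClass (n : ℕ) (V : FGMod S) (D : Set (FGMod S)) (C : Set (FGMod S)) : Prop :=
  ∀ M ∈ C, ∃ V1 V0 D1 D0 : FGMod S,
    V1 ∈ addOf {V} ∧ V0 ∈ addOf {V} ∧ D1 ∈ D ∧ D0 ∈ D ∧
    SES (prodMod V1 D1) (prodMod V0 D0) (syz^[n] M)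

/-- `[C]_D`: the image of `⟨C⟩` in `K_D`, i.e. `(⟨C⟩ + ⟨D⟩)/⟨D⟩`. -/
def classGrpD (D C : Set (FGMod S)) : AddSubgroup (KD D) :=
  (grpOf C).map (QuotientAddGroup.mk' (grpOf D))

/-- `C` is `D`-syzygy finite: `[Ω^k(C)]_D` is finitely generated for some `k`. -/
def DSyzFinite (D C : Set (FGMod S)) : Prop :=
  ∃ k : ℕ, (classGrpD D ((fun M => syz^[k] M) '' C)).FG

/-- The algebra is `n`-LIT: there are a `0`-Igusa–Todorov subcategory `D` and a module `V`
such that `mod A` is `(n,V,D)`-LIT. -/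
def IsNLITAlgebra (L : AddMonoid.End (K0 S)) (n : ℕ) : Prop :=
  ∃ (V : FGMod S) (D : Set (FGMod S)), IsZeroIT L D ∧ IsLITClass n V D Set.univ

/-- The algebra is LIT: it is `n`-LIT for some `n`. -/
def IsLITAlgebra (L : AddMonoid.End (K0 S)) : Prop :=
  ∃ n : ℕ, IsNLITAlgebra L n


/-! ### Projective covers and syzygies -/

section Covers

variable {S : Type u} [Ring S]

/-- The kernel of a surjection between projective modules is projective. -/
lemma projective_ker {P Q : Type*} [AddCommGroup P] [Module S P] [AddCommGroup Q] [Module S Q]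
    [Module.Projective S P] [Module.Projective S Q] (f : P →ₗ[S] Q) (hf : Surjective f) :
    Module.Projective S (LinearMap.ker f) := by
  obtain ⟨s, hs⟩ := LinearMap.exists_rightInverse_of_surjective f (LinearMap.range_eq_top.2 hf)
  have hs' : ∀ x, f (s x) = x := fun x => LinearMap.congr_fun hs x
  refine Module.Projective.of_split (LinearMap.ker f).subtype
    (LinearMap.codRestrict (LinearMap.ker f) (LinearMap.id - s ∘ₗ f) fun x => ?_) ?_
  · simp [hs']
  · ext ⟨x, hx⟩
    simp [LinearMap.mem_ker.1 hx]

/-- A direct summand of a projective module is projective. -/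
lemma projective_of_prod {P M N : Type*} [AddCommGroup P] [Module S P] [AddCommGroup M]
    [Module S M] [AddCommGroup N] [Module S N] [Module.Projective S P]
    (e : P ≃ₗ[S] M × N) : Module.Projective S M :=
  Module.Projective.of_split (e.symm.toLinearMap ∘ₗ LinearMap.inl S M N)
    (LinearMap.fst S M N ∘ₗ e.toLinearMap) (by ext; simp)

/-- A surjection from a projective module onto `W` splits off a projective cover of `W`. -/
lemma exists_split_of_isProjCover {C P W : FGMod S} {c : C.carrier →ₗ[S] W.carrier}
    (hc : IsProjCover c) (p : P.carrier →ₗ[S] W.carrier) (hp : Surjective p) (hP : P.IsProj) :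
    ∃ (h : P.carrier →ₗ[S] C.carrier) (s : C.carrier →ₗ[S] P.carrier),
      (∀ x, c (h x) = p x) ∧ (∀ x, h (s x) = x) ∧ (∀ x, p (s x) = c x) := by
  obtain ⟨hC, hcs, hsup⟩ := hc
  have : Module.Projective S P.carrier := hP
  have : Module.Projective S C.carrier := hC
  obtain ⟨h, hh⟩ := Module.projective_lifting_property c p hcs
  have hh' : ∀ x, c (h x) = p x := fun x => LinearMap.congr_fun hh x
  have htop : LinearMap.range h = ⊤ := by
    apply hsup
    rw [eq_top_iff]
    intro x _
    obtain ⟨y, hy⟩ := hp (c x)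
    rw [← sub_add_cancel x (h y), add_comm]
    exact Submodule.add_mem_sup ⟨y, rfl⟩ (by simp [hh', hy])
  obtain ⟨s, hs⟩ := LinearMap.exists_rightInverse_of_surjective h htop
  have hs' : ∀ x, h (s x) = x := fun x => LinearMap.congr_fun hs x
  exact ⟨h, s, hh', hs', fun x => by rw [← hh', hs']⟩

lemma FGMod.IsProjCover.ker_equiv {P Q M : FGMod S} {f : P.carrier →ₗ[S] M.carrier}
    {g : Q.carrier →ₗ[S] M.carrier} (hf : IsProjCover f) (hg : IsProjCover g) :
    Nonempty (LinearMap.ker f ≃ₗ[S] LinearMap.ker g) := by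
  obtain ⟨h, s, hh, hs, hps⟩ := exists_split_of_isProjCover hf g hg.2.1 hg.1
  have htop : LinearMap.range s = ⊤ := by
    apply hg.2.2
    rw [eq_top_iff]
    intro x _
    rw [← sub_add_cancel x (s (h x)), add_comm]
    exact Submodule.add_mem_sup ⟨_, rfl⟩ (by simp [hps, hh])
  have hinj : Injective s := LeftInverse.injective hs
  refine ⟨LinearEquiv.ofBijective (s.restrict (p := LinearMap.ker f) (q := LinearMap.ker g)
    fun x hx => ?_) ⟨?_, ?_⟩⟩
  · simpa [hps] using hx
  · intro x y hxy
    exact Subtype.ext (hinj (congrArg Subtype.val hxy))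
  · rintro ⟨y, hy⟩
    obtain ⟨x, rfl⟩ := LinearMap.range_eq_top.1 htop y
    exact ⟨⟨x, by simpa [hps] using hy⟩, rfl⟩

variable [IsArtinianRing S]

/-- Over an artinian ring, every finitely generated module has a projective cover. -/
theorem exists_isProjCover (M : FGMod S) :
    ∃ (P : FGMod S) (f : P.carrier →ₗ[S] M.carrier), IsProjCover f := by
  classical
  let p : ℕ → Prop := fun n => ∃ (P : FGMod S) (f : P.carrier →ₗ[S] M.carrier),
    P.IsProj ∧ Surjective f ∧ Module.length S P.carrier = n
  have hlen : ∀ P : FGMod S, ∃ n : ℕ, Module.length S P.carrier = n := fun P =>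
    ⟨_, (ENat.natCast_toNat Module.length_ne_top).symm⟩
  have hex : ∃ n, p n := by
    obtain ⟨m, f, hf⟩ := Module.Finite.exists_fin' S M.carrier
    obtain ⟨n, hn⟩ := hlen ⟨Fin m → S⟩
    exact ⟨n, ⟨Fin m → S⟩, f, inferInstanceAs (Module.Projective S (Fin m → S)), hf, hn⟩
  obtain ⟨P, f, hP, hf, hn⟩ := Nat.find_spec hex
  refine ⟨P, f, hP, hf, fun N hN => ?_⟩
  by_contra hne
  have : Module.Projective S P.carrier := hP
  have hfN : Surjective (f ∘ₗ N.subtype) := by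
    intro y
    obtain ⟨x, rfl⟩ := hf y
    obtain ⟨a, ha, b, hb, rfl⟩ := Submodule.mem_sup.1 (hN ▸ Submodule.mem_top : x ∈ N ⊔ f.ker)
    exact ⟨⟨a, ha⟩, by simpa using hb⟩
  obtain ⟨h₀, hh₀⟩ := Module.projective_lifting_property (f ∘ₗ N.subtype) f hfN
  let h : Module.End S P.carrier := N.subtype ∘ₗ h₀
  have hfh : ∀ x, f (h x) = f x := fun x => LinearMap.congr_fun hh₀ x
  obtain ⟨k, hk, hk1⟩ := (h.eventually_isCompl_ker_pow_range_pow.and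
    (Filter.eventually_ge_atTop 1)).exists
  have hfk : ∀ (j : ℕ) (x), f ((h ^ j) x) = f x := by
    intro j
    induction j with
    | zero => simp
    | succ j ih => intro x; rw [pow_succ', Module.End.mul_apply, hfh, ih]
  have hrange : LinearMap.range (h ^ k) ≠ ⊤ := by
    intro htop
    apply hne
    rw [eq_top_iff, ← htop]
    rintro _ ⟨x, rfl⟩
    obtain ⟨j, rfl⟩ : ∃ j, k = j + 1 := ⟨k - 1, by omega⟩
    rw [pow_succ', Module.End.mul_apply]
    exact (h₀ _).2
  obtain ⟨m, hm⟩ := hlen ⟨LinearMap.range (h ^ k)⟩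
  have hlt := Submodule.length_lt hrange
  rw [show Module.length S (LinearMap.range (h ^ k)) = m from hm, hn, Nat.cast_lt] at hlt
  refine Nat.find_min hex hlt ⟨⟨LinearMap.range (h ^ k)⟩, f ∘ₗ Submodule.subtype _, ?_, ?_, hm⟩
  · exact projective_of_prod (Submodule.prodEquivOfIsCompl _ _ hk.symm).symm
  · intro y
    obtain ⟨x, rfl⟩ := hf y
    exact ⟨⟨_, x, rfl⟩, hfk k x⟩

lemma isSyzygyOf_syz (M : FGMod S) : IsSyzygyOf (syz M) M := by
  have h : ∃ N, IsSyzygyOf N M := by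
    obtain ⟨P, f, hf⟩ := exists_isProjCover M
    exact ⟨⟨LinearMap.ker f⟩, P, f, hf, ⟨LinearEquiv.refl _ _⟩⟩
  rw [syz, dif_pos h]
  exact h.choose_spec

end Covers

/-! ### Isomorphisms, direct summands and additive closures -/

section Add

variable {S : Type u} [Ring S]

/-- Isomorphism of modules. -/
def Iso (M N : FGMod S) : Prop := Nonempty (M.carrier ≃ₗ[S] N.carrier)

lemma Iso.refl (M : FGMod S) : Iso M M := ⟨LinearEquiv.refl _ _⟩

lemma Iso.symm {M N : FGMod S} : Iso M N → Iso N M := fun ⟨e⟩ => ⟨e.symm⟩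

lemma Iso.trans {M N K : FGMod S} : Iso M N → Iso N K → Iso M K :=
  fun ⟨e⟩ ⟨e'⟩ => ⟨e.trans e'⟩

lemma Iso.prod {M N M' N' : FGMod S} :
    Iso M M' → Iso N N' → Iso (prodMod M N) (prodMod M' N') :=
  fun ⟨e⟩ ⟨e'⟩ => ⟨LinearEquiv.prodCongr e e'⟩

lemma Iso.prodAssoc (M N K : FGMod S) :
    Iso (prodMod (prodMod M N) K) (prodMod M (prodMod N K)) :=
  ⟨LinearEquiv.prodAssoc S _ _ _⟩

lemma Iso.prodComm (M N : FGMod S) : Iso (prodMod M N) (prodMod N M) :=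
  ⟨LinearEquiv.prodComm S _ _⟩

lemma Iso.prodProdProdComm (M N M' N' : FGMod S) :
    Iso (prodMod (prodMod M N) (prodMod M' N')) (prodMod (prodMod M M') (prodMod N N')) :=
  ⟨LinearEquiv.prodProdProdComm S _ _ _ _⟩

lemma Iso.of_subsingleton (M N : FGMod S) [Subsingleton M.carrier] [Subsingleton N.carrier] :
    Iso M N := ⟨LinearEquiv.ofSubsingleton _ _⟩

/-- The zero module. -/
def zeroMod (S : Type u) [Ring S] : FGMod S := ⟨PUnit⟩

instance : Subsingleton (zeroMod S).carrier := inferInstanceAs (Subsingleton PUnit)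

lemma Iso.prod_subsingleton (M N : FGMod S) [Subsingleton N.carrier] : Iso M (prodMod M N) :=
  letI : Unique N.carrier := ⟨⟨0⟩, fun _ => Subsingleton.elim _ _⟩
  ⟨LinearEquiv.prodUnique.symm⟩

lemma FGMod.IsSummand.exists_iso {N M : FGMod S} :
    IsSummand N M → ∃ N', Iso M (prodMod N N') := fun h => h

lemma isSummand_of_iso {N M N' : FGMod S} (h : Iso M (prodMod N N')) : IsSummand N M := ⟨N', h⟩

lemma Iso.isSummand {N M : FGMod S} (h : Iso M N) : IsSummand N M :=
  ⟨zeroMod S, h.trans (Iso.prod_subsingleton _ _)⟩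

lemma FGMod.IsSummand.refl (M : FGMod S) : IsSummand M M := (Iso.refl M).isSummand

lemma FGMod.IsSummand.trans {K N M : FGMod S} (h : IsSummand K N) (h' : IsSummand N M) :
    IsSummand K M := by
  obtain ⟨K', e⟩ := h.exists_iso
  obtain ⟨N', e'⟩ := h'.exists_iso
  exact isSummand_of_iso (e'.trans ((e.prod (Iso.refl N')).trans (Iso.prodAssoc _ _ _)))

lemma isSummand_left (M N : FGMod S) : IsSummand M (prodMod M N) := ⟨N, Iso.refl _⟩

lemma isSummand_right (M N : FGMod S) : IsSummand N (prodMod M N) := ⟨M, Iso.prodComm _ _⟩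

lemma FGMod.IsSummand.prod {M N M' N' : FGMod S} (h : IsSummand M M') (h' : IsSummand N N') :
    IsSummand (prodMod M N) (prodMod M' N') := by
  obtain ⟨K, e⟩ := h.exists_iso
  obtain ⟨K', e'⟩ := h'.exists_iso
  exact isSummand_of_iso ((e.prod e').trans (Iso.prodProdProdComm _ _ _ _))

variable {C : Set (FGMod S)}

lemma addOf_summand {M N : FGMod S} (hM : M ∈ addOf C) (h : IsSummand N M) : N ∈ addOf C := by
  obtain ⟨n, f, hf, hs⟩ := hM
  exact ⟨n, f, hf, h.trans hs⟩

lemma addOf_iso {M N : FGMod S} (hM : M ∈ addOf C) (h : Iso M N) : N ∈ addOf C :=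
  addOf_summand hM h.isSummand

lemma subset_addOf {M : FGMod S} (hM : M ∈ C) : M ∈ addOf C :=
  ⟨1, fun _ => M, fun _ => hM, Iso.isSummand ⟨LinearEquiv.funUnique (Fin 1) S M.carrier⟩⟩

lemma subsingleton_mem_addOf (M : FGMod S) [Subsingleton M.carrier] : M ∈ addOf C := by
  have : Subsingleton (dsum (fun i : Fin 0 => (Fin.elim0 i : FGMod S))).carrier :=
    ⟨fun a b => funext fun i => Fin.elim0 i⟩
  exact ⟨0, fun i => Fin.elim0 i, fun i => Fin.elim0 i, (Iso.of_subsingleton _ _).isSummand⟩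

lemma addOf_prod {M N : FGMod S} (hM : M ∈ addOf C) (hN : N ∈ addOf C) :
    prodMod M N ∈ addOf C := by
  obtain ⟨m, f, hf, hs⟩ := hM
  obtain ⟨n, g, hg, ht⟩ := hN
  let h : Fin m ⊕ Fin n → FGMod S := Sum.elim f g
  have e : Iso (dsum fun i => h (finSumFinEquiv.symm i)) (prodMod (dsum f) (dsum g)) :=
    ⟨(LinearEquiv.piCongrLeft S (fun i => (h i).carrier) finSumFinEquiv.symm).trans
      (LinearEquiv.sumPiEquivProdPi S _ _ fun i => (h i).carrier)⟩
  refine ⟨m + n, fun i => h (finSumFinEquiv.symm i), fun i => ?_, (hs.prod ht).trans e.isSummand⟩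
  change h (finSumFinEquiv.symm i) ∈ C
  rcases finSumFinEquiv.symm i with j | j
  · exact hf j
  · exact hg j

lemma dsum_succ {n : ℕ} (f : Fin (n + 1) → FGMod S) :
    Iso (dsum f) (prodMod (f 0) (dsum fun i => f i.succ)) :=
  ⟨(Fin.consLinearEquiv S fun i => (f i).carrier).symm⟩

/-- Membership in `addOf C` is preserved by additive operations on modules. -/
lemma addOf_map {F : FGMod S → FGMod S} {B : Set (FGMod S)}
    (hiso : ∀ {M N}, Iso M N → Iso (F M) (F N))
    (hprod : ∀ M N, Iso (F (prodMod M N)) (prodMod (F M) (F N)))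
    (hzero : ∀ M : FGMod S, Subsingleton M.carrier → F M ∈ addOf B)
    (hC : ∀ M ∈ C, F M ∈ addOf B) {M : FGMod S} (hM : M ∈ addOf C) : F M ∈ addOf B := by
  obtain ⟨n, f, hf, hs⟩ := hM
  obtain ⟨N, hN⟩ := hs.exists_iso
  refine addOf_summand (M := F (dsum f)) ?_ (isSummand_of_iso ((hiso hN).trans (hprod _ _)))
  clear hs hN
  induction n with
  | zero => exact hzero _ ⟨fun a b => funext fun i => Fin.elim0 i⟩
  | succ n ih =>
    refine addOf_iso ?_ ((hiso (dsum_succ f)).trans (hprod _ _)).symm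
    exact addOf_prod (hC _ (hf 0)) (ih _ fun i => hf _)

lemma addOf_trans {B : Set (FGMod S)} (h : C ⊆ addOf B) : addOf C ⊆ addOf B := fun _ hM =>
  addOf_map (F := id) (fun h => h) (fun _ _ => Iso.refl _)
    (fun M _ => subsingleton_mem_addOf M) h hM

lemma addOf_singleton_mono {V W : FGMod S} (h : IsSummand V W) : addOf {V} ⊆ addOf {W} :=
  addOf_trans fun M hM => by
    rw [Set.mem_singleton_iff.1 hM]
    exact addOf_summand (subset_addOf rfl) h

/-- Finitely generated projective modules lie in `add` of the regular module. -/
lemma FGMod.IsProj.mem_addOf {P : FGMod S} (hP : P.IsProj) : P ∈ addOf {regular S} := by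
  have : Module.Projective S P.carrier := hP
  obtain ⟨n, f, hf⟩ := Module.Finite.exists_fin' S P.carrier
  obtain ⟨s, hs⟩ := LinearMap.exists_rightInverse_of_surjective f (LinearMap.range_eq_top.2 hf)
  have hs' : ∀ x, f (s x) = x := fun x => LinearMap.congr_fun hs x
  let r : (Fin n → S) →ₗ[S] LinearMap.ker f :=
    LinearMap.codRestrict _ (LinearMap.id - s ∘ₗ f) fun x => by simp [hs']
  have : Module.Finite S (LinearMap.ker f) := Module.Finite.of_surjective r fun x =>
    ⟨x, Subtype.ext (by simp [r, LinearMap.mem_ker.1 x.2])⟩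
  refine ⟨n, fun _ => regular S, fun _ => rfl, ⟨LinearMap.ker f⟩, ⟨?_⟩⟩
  refine LinearEquiv.ofBijective (M := Fin n → S) (f.prod r) ⟨fun x y hxy => ?_, fun y => ?_⟩
  · have h1 : f x = f y := congrArg Prod.fst hxy
    have h2 : x - s (f x) = y - s (f y) := congrArg Subtype.val (congrArg Prod.snd hxy)
    simpa [h1] using h2
  · refine ⟨s y.1 + y.2, Prod.ext ?_ (Subtype.ext ?_)⟩
    · simp [hs', LinearMap.mem_ker.1 y.2.2]
    · simp [r, hs', LinearMap.mem_ker.1 y.2.2]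

lemma FGMod.IsProj.of_isSummand {P N : FGMod S} (hP : P.IsProj) : IsSummand N P → N.IsProj := by
  rintro ⟨N', ⟨e⟩⟩
  have : Module.Projective S P.carrier := hP
  exact projective_of_prod e

lemma FGMod.IsProj.prod {P Q : FGMod S} (hP : P.IsProj) (hQ : Q.IsProj) : (prodMod P Q).IsProj := by
  have : Module.Projective S P.carrier := hP
  have : Module.Projective S Q.carrier := hQ
  exact inferInstanceAs (Module.Projective S (P.carrier × Q.carrier))

lemma FGMod.SES.congr {X Y Z X' Y' Z' : FGMod S} (hX : Iso X X') (hY : Iso Y Y') (hZ : Iso Z Z') :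
    SES X Y Z → SES X' Y' Z' := by
  rintro ⟨f, g, hf, hg, hfg⟩
  obtain ⟨eX⟩ := hX
  obtain ⟨eY⟩ := hY
  obtain ⟨eZ⟩ := hZ
  refine ⟨eY.toLinearMap ∘ₗ f ∘ₗ eX.symm.toLinearMap,
    eZ.toLinearMap ∘ₗ g ∘ₗ eY.symm.toLinearMap, ?_, ?_, ?_⟩
  · exact eY.injective.comp (hf.comp eX.symm.injective)
  · exact eZ.surjective.comp (hg.comp eY.symm.surjective)
  · ext y
    have := SetLike.ext_iff.1 hfg (eY.symm y)
    simp only [LinearMap.mem_range, LinearMap.mem_ker, LinearMap.comp_apply,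
      LinearEquiv.coe_coe, LinearEquiv.map_eq_zero_iff] at this ⊢
    rw [← this]
    constructor
    · rintro ⟨x, rfl⟩
      exact ⟨eX.symm x, by simp⟩
    · rintro ⟨x, hx⟩
      exact ⟨eX x, by simp [hx]⟩

end Add

/-! ### Syzygies of direct sums and of short exact sequences -/

section Syzygy

variable {S : Type u} [Ring S]

/-- The product of superfluous submodules is superfluous. -/
lemma superfluous_prod {P Q : Type*} [AddCommGroup P] [Module S P] [AddCommGroup Q] [Module S Q]
    {A : Submodule S P} {B : Submodule S Q} (hA : ∀ N : Submodule S P, N ⊔ A = ⊤ → N = ⊤)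
    (hB : ∀ N : Submodule S Q, N ⊔ B = ⊤ → N = ⊤) (K : Submodule S (P × Q))
    (hK : K ⊔ A.prod B = ⊤) : K = ⊤ := by
  have h1 : K ⊔ A.prod ⊥ = ⊤ := by
    have hc : (K ⊔ A.prod ⊥).comap (LinearMap.inr S P Q) = ⊤ := by
      apply hB
      rw [eq_top_iff]
      intro y _
      obtain ⟨k, hk, ⟨a, b⟩, ⟨ha, hb⟩, hab⟩ :=
        Submodule.mem_sup.1 (hK ▸ Submodule.mem_top : ((0 : P), y) ∈ K ⊔ A.prod B)
      refine Submodule.mem_sup.2 ⟨y - b, ?_, b, hb, sub_add_cancel _ _⟩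
      refine Submodule.mem_sup.2 ⟨k, hk, (a, 0), ⟨ha, Submodule.zero_mem _⟩, ?_⟩
      rw [← eq_sub_iff_add_eq] at hab
      subst hab
      simp
    rw [eq_top_iff, ← hK]
    refine sup_le le_sup_left ?_
    rintro ⟨a, b⟩ ⟨ha, -⟩
    have hb : b ∈ (K ⊔ A.prod ⊥).comap (LinearMap.inr S P Q) := hc ▸ Submodule.mem_top
    have ha' : (a, (0 : Q)) ∈ K ⊔ A.prod ⊥ :=
      Submodule.mem_sup_right ⟨ha, Submodule.zero_mem _⟩
    have := Submodule.add_mem _ ha' (Submodule.mem_comap.1 hb)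
    simpa using this
  have h2 : K.comap (LinearMap.inl S P Q) = ⊤ := by
    apply hA
    rw [eq_top_iff]
    intro x _
    obtain ⟨k, hk, ⟨a, b⟩, ⟨ha, hb⟩, hab⟩ :=
      Submodule.mem_sup.1 (h1 ▸ Submodule.mem_top : (x, (0 : Q)) ∈ K ⊔ A.prod ⊥)
    obtain rfl : b = 0 := hb
    refine Submodule.mem_sup.2 ⟨x - a, ?_, a, ha, sub_add_cancel _ _⟩
    rw [← eq_sub_iff_add_eq] at hab
    subst hab
    simpa using hk
  rw [← h1, left_eq_sup]
  rintro ⟨a, b⟩ ⟨-, hb⟩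
  obtain rfl : b = 0 := hb
  exact (h2 ▸ Submodule.mem_top : a ∈ K.comap (LinearMap.inl S P Q))

lemma isProjCover_prod {P Q M N : FGMod S} {f : P.carrier →ₗ[S] M.carrier}
    {g : Q.carrier →ₗ[S] N.carrier} (hf : IsProjCover f) (hg : IsProjCover g) :
    IsProjCover (P := prodMod P Q) (M := prodMod M N) (f.prodMap g) :=
  ⟨FGMod.IsProj.prod hf.1 hg.1, hf.2.1.prodMap hg.2.1, fun K hK =>
    superfluous_prod hf.2.2 hg.2.2 K (by rw [← LinearMap.ker_prodMap]; exact hK)⟩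

/-- The product of two submodules is isomorphic to their external product. -/
def submoduleProdEquiv {P Q : Type*} [AddCommGroup P] [Module S P] [AddCommGroup Q] [Module S Q]
    (A : Submodule S P) (B : Submodule S Q) : A.prod B ≃ₗ[S] A × B where
  toFun x := (⟨x.1.1, x.2.1⟩, ⟨x.1.2, x.2.2⟩)
  invFun y := ⟨(y.1, y.2), y.1.2, y.2.2⟩
  map_add' _ _ := rfl
  map_smul' _ _ := rfl
  left_inv _ := rfl
  right_inv _ := rfl

variable [IsArtinianRing S]

lemma syz_iso_of_isProjCover {P M : FGMod S} {f : P.carrier →ₗ[S] M.carrier}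
    (hf : IsProjCover f) : Nonempty ((syz M).carrier ≃ₗ[S] LinearMap.ker f) := by
  obtain ⟨Q, g, hg, ⟨e⟩⟩ := isSyzygyOf_syz M
  obtain ⟨e'⟩ := hg.ker_equiv hf
  exact ⟨e.trans e'⟩

lemma Iso.syz {M N : FGMod S} (h : Iso M N) : Iso (syz M) (syz N) := by
  obtain ⟨e⟩ := h
  obtain ⟨P, f, hf, ⟨e'⟩⟩ := isSyzygyOf_syz M
  have hker : LinearMap.ker (e.toLinearMap ∘ₗ f) = LinearMap.ker f := by
    rw [LinearMap.ker_comp_of_ker_eq_bot _ (LinearMap.ker_eq_bot.2 e.injective)]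
  have hc : IsProjCover (P := P) (M := N) (e.toLinearMap ∘ₗ f) :=
    ⟨hf.1, e.surjective.comp hf.2.1, by rw [hker]; exact hf.2.2⟩
  obtain ⟨e''⟩ := syz_iso_of_isProjCover hc
  exact ⟨e'.trans ((LinearEquiv.ofEq _ _ hker.symm).trans e''.symm)⟩

lemma syz_prod (M N : FGMod S) :
    Iso (syz (prodMod M N)) (prodMod (syz M) (syz N)) := by
  obtain ⟨P, f, hf, ⟨e⟩⟩ := isSyzygyOf_syz M
  obtain ⟨Q, g, hg, ⟨e'⟩⟩ := isSyzygyOf_syz N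
  obtain ⟨e''⟩ := syz_iso_of_isProjCover (isProjCover_prod hf hg)
  refine ⟨e''.trans ((LinearEquiv.ofEq _ _ (LinearMap.ker_prodMap f g)).trans
    ((submoduleProdEquiv _ _).trans (LinearEquiv.prodCongr e.symm e'.symm)))⟩

lemma isProj_syz {P : FGMod S} (hP : P.IsProj) : (syz P).IsProj := by
  obtain ⟨Q, g, hg, ⟨e⟩⟩ := isSyzygyOf_syz P
  have : Module.Projective S P.carrier := hP
  have : Module.Projective S Q.carrier := hg.1
  have := projective_ker g hg.2.1
  exact Module.Projective.of_equiv e.symm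

lemma syz_subsingleton (M : FGMod S) [Subsingleton M.carrier] : Subsingleton (syz M).carrier := by
  obtain ⟨Q, g, hg, ⟨e⟩⟩ := isSyzygyOf_syz M
  have h : (⊥ : Submodule S Q.carrier) = ⊤ := hg.2.2 _ (by
    rw [bot_sup_eq, LinearMap.ker_eq_top]; ext; exact Subsingleton.elim _ _)
  have : Subsingleton Q.carrier := Submodule.subsingleton_iff S |>.1 (subsingleton_of_bot_eq_top h)
  exact e.injective.subsingleton

/-- The kernel of a surjection from a projective module is the syzygy up to a projective
summand. -/
lemma exists_ker_equiv_syz_prod {P W : FGMod S} (p : P.carrier →ₗ[S] W.carrier)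
    (hp : Surjective p) (hP : P.IsProj) :
    ∃ Q : FGMod S, Q.IsProj ∧
      Nonempty (LinearMap.ker p ≃ₗ[S] (syz W).carrier × Q.carrier) := by
  obtain ⟨C, c, hc, ⟨e⟩⟩ := isSyzygyOf_syz W
  obtain ⟨h, s, hh, hs, hps⟩ := exists_split_of_isProjCover hc p hp hP
  have : Module.Projective S P.carrier := hP
  have : Module.Projective S C.carrier := hc.1
  refine ⟨⟨LinearMap.ker h⟩, projective_ker h (RightInverse.surjective hs), ?_⟩
  let t : LinearMap.ker p →ₗ[S] LinearMap.ker c :=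
    h.restrict fun x hx => by simpa [hh] using hx
  let r : LinearMap.ker p →ₗ[S] LinearMap.ker h :=
    LinearMap.codRestrict _ ((LinearMap.id - s ∘ₗ h) ∘ₗ (LinearMap.ker p).subtype) fun x => by
      simp [hs]
  have ht : ∀ x, (t x : C.carrier) = h x := fun _ => rfl
  have hr : ∀ x, (r x : P.carrier) = x - s (h x) := fun _ => rfl
  refine ⟨(LinearEquiv.ofBijective (t.prod r) ⟨fun x y hxy => ?_, fun y => ?_⟩).trans
    (LinearEquiv.prodCongr e.symm (LinearEquiv.refl _ _))⟩
  · have h1 : h x = h y := congrArg Subtype.val (congrArg Prod.fst hxy)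
    have h2 : (x : P.carrier) - s (h x) = y - s (h y) :=
      congrArg Subtype.val (congrArg Prod.snd hxy)
    rw [h1] at h2
    exact Subtype.ext (sub_left_injective h2)
  · obtain ⟨⟨a, ha⟩, ⟨b, hb⟩⟩ := y
    have ha' : c a = 0 := ha
    have hb' : h b = 0 := hb
    refine ⟨⟨s a + b, ?_⟩, Prod.ext (Subtype.ext ?_) (Subtype.ext ?_)⟩
    · simp [ha', ← hh, hs, hb']
    · simp [ht, hs, hb']
    · simp [hr, hs, hb']

/-- The horseshoe lemma. -/
lemma ses_syz {U W M : FGMod S} (h : SES U W M) :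
    ∃ Q : FGMod S, Q.IsProj ∧ SES (syz U) (prodMod (syz W) Q) (syz M) := by
  obtain ⟨i, q, hi, hq, hiq⟩ := h
  obtain ⟨P, a, ha, ⟨eU⟩⟩ := isSyzygyOf_syz U
  obtain ⟨B, b, hb, ⟨eM⟩⟩ := isSyzygyOf_syz M
  have : Module.Projective S P.carrier := ha.1
  have : Module.Projective S B.carrier := hb.1
  obtain ⟨l, hl⟩ := Module.projective_lifting_property q b hq
  have hl' : ∀ x, q (l x) = b x := fun x => LinearMap.congr_fun hl x
  have hqi : ∀ x, q (i x) = 0 := fun x =>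
    LinearMap.mem_ker.1 (hiq ▸ LinearMap.mem_range_self i x)
  have hex : ∀ y, q y = 0 → ∃ x, i (a x) = y := by
    intro y hy
    obtain ⟨x, rfl⟩ : y ∈ LinearMap.range i := hiq ▸ LinearMap.mem_ker.2 hy
    obtain ⟨z, rfl⟩ := ha.2.1 x
    exact ⟨z, rfl⟩
  let p : (prodMod P B).carrier →ₗ[S] W.carrier := (i ∘ₗ a).coprod l
  have hp' : ∀ x y, p (x, y) = i (a x) + l y := fun _ _ => rfl
  have hp : Surjective p := by
    intro w
    obtain ⟨y, hy⟩ := hb.2.1 (q w)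
    obtain ⟨x, hx⟩ := hex (w - l y) (by rw [map_sub, hl', hy, sub_self])
    exact ⟨(x, y), by rw [hp', hx, sub_add_cancel]⟩
  obtain ⟨Q, hQ, ⟨e⟩⟩ := exists_ker_equiv_syz_prod p hp (FGMod.IsProj.prod ha.1 hb.1)
  refine ⟨Q, hQ, ?_⟩
  refine FGMod.SES.congr (X := ⟨LinearMap.ker a⟩) (Y := ⟨LinearMap.ker p⟩) (Z := ⟨LinearMap.ker b⟩)
    ⟨eU.symm⟩ ⟨e⟩ ⟨eM.symm⟩ ?_
  refine ⟨LinearMap.codRestrict _ (LinearMap.inl S P.carrier B.carrier ∘ₗ Submodule.subtype _)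
      fun x => ?_,
    LinearMap.codRestrict _ (LinearMap.snd S P.carrier B.carrier ∘ₗ Submodule.subtype _)
      fun x => ?_, ?_, ?_, ?_⟩
  · have hx : a x = 0 := x.2
    change p (x, 0) = 0
    simp [hp', hx]
  · obtain ⟨⟨x, y⟩, hxy⟩ := x
    have hxy' : i (a x) + l y = 0 := hxy
    change b y = 0
    simpa [hqi, hl'] using congrArg q hxy'
  · intro x y hxy
    exact Subtype.ext (congrArg Prod.fst (congrArg Subtype.val hxy))
  · rintro ⟨y, hy⟩
    obtain ⟨x, hx⟩ := hex (l y) (by rw [hl']; exact hy)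
    exact ⟨⟨(-x, y), by change p (-x, y) = 0; rw [hp', map_neg, map_neg, hx, neg_add_cancel]⟩, rfl⟩
  · ext ⟨⟨x, y⟩, hxy⟩
    have hxy' : i (a x) + l y = 0 := hxy
    constructor
    · rintro ⟨z, hz⟩
      exact Subtype.ext (congrArg Prod.snd (congrArg Subtype.val hz)).symm
    · intro hz
      obtain rfl : y = 0 := congrArg Subtype.val hz
      have hx : a x = 0 := hi (by simpa using hxy')
      exact ⟨⟨x, hx⟩, rfl⟩

/-- Rotation of a short exact sequence. -/
lemma ses_rotate {X M Y : FGMod S} (h : SES X M Y) :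
    ∃ Q : FGMod S, Q.IsProj ∧ SES (syz Y) (prodMod X Q) M := by
  obtain ⟨f, g, hf, hg, hfg⟩ := h
  obtain ⟨Q, c, hc, ⟨e⟩⟩ := isSyzygyOf_syz Y
  have : Module.Projective S Q.carrier := hc.1
  obtain ⟨l, hl⟩ := Module.projective_lifting_property g c hg
  have hl' : ∀ x, g (l x) = c x := fun x => LinearMap.congr_fun hl x
  have hgf : ∀ x, g (f x) = 0 := fun x =>
    LinearMap.mem_ker.1 (hfg ▸ LinearMap.mem_range_self f x)
  have hex : ∀ y, g y = 0 → ∃ x, f x = y := fun y hy =>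
    (hfg ▸ LinearMap.mem_ker.2 hy : y ∈ LinearMap.range f)
  let p : (prodMod X Q).carrier →ₗ[S] M.carrier := f.coprod l
  have hp' : ∀ x y, p (x, y) = f x + l y := fun _ _ => rfl
  let t : LinearMap.ker p →ₗ[S] LinearMap.ker c :=
    LinearMap.codRestrict _ (LinearMap.snd S X.carrier Q.carrier ∘ₗ Submodule.subtype _) (by
      rintro ⟨⟨x, y⟩, hxy⟩
      have hxy' : f x + l y = 0 := hxy
      change c y = 0
      simpa [hgf, hl'] using congrArg g hxy')
  have ht : Bijective t := by
    constructor
    · rw [← LinearMap.ker_eq_bot, LinearMap.ker_eq_bot']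
      rintro ⟨⟨x, y⟩, hxy⟩ hz
      have hxy' : f x + l y = 0 := hxy
      obtain rfl : y = 0 := congrArg Subtype.val hz
      obtain rfl : x = 0 := hf (by simpa using hxy')
      rfl
    · rintro ⟨y, hy⟩
      obtain ⟨x, hx⟩ := hex (l y) (by rw [hl']; exact hy)
      exact ⟨⟨(-x, y), by change p (-x, y) = 0; rw [hp', map_neg, hx, neg_add_cancel]⟩, rfl⟩
  refine ⟨Q, hc.1, FGMod.SES.congr (X := ⟨LinearMap.ker p⟩)
    ⟨(LinearEquiv.ofBijective t ht).trans e.symm⟩ (Iso.refl _) (Iso.refl _)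
    ⟨(LinearMap.ker p).subtype, p, Subtype.val_injective, ?_, ?_⟩⟩
  · intro m
    obtain ⟨y, hy⟩ := hc.2.1 (g m)
    obtain ⟨x, hx⟩ := hex (m - l y) (by rw [map_sub, hl', hy, sub_self])
    exact ⟨(x, y), by rw [hp', hx, sub_add_cancel]⟩
  · exact Submodule.range_subtype _

lemma ses_syz_iterate {X M Y : FGMod S} (h : SES X M Y) (k : ℕ) :
    ∃ Q : FGMod S, Q.IsProj ∧ SES (syz^[k + 1] Y) (prodMod (syz^[k] X) Q) (syz^[k] M) := by
  induction k with
  | zero => exact ses_rotate h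
  | succ k ih =>
    obtain ⟨Q, hQ, hk⟩ := ih
    obtain ⟨Q', hQ', hk'⟩ := ses_syz hk
    refine ⟨prodMod (syz Q) Q', FGMod.IsProj.prod (isProj_syz hQ) hQ', ?_⟩
    simp only [Function.iterate_succ_apply' syz]
    simp only [Function.iterate_succ_apply' syz] at hk'
    exact hk'.congr (Iso.refl _)
      (((syz_prod _ _).prod (Iso.refl _)).trans (Iso.prodAssoc _ _ _)) (Iso.refl _)

lemma addOf_syz {V M : FGMod S} (h : M ∈ addOf {V}) : syz M ∈ addOf {syz V} :=
  addOf_map (F := syz) Iso.syz syz_prod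
    (fun M _ => have := syz_subsingleton M; subsingleton_mem_addOf _)
    (fun M hM => by rw [Set.mem_singleton_iff.1 hM]; exact subset_addOf rfl) h

/-- `M` is a direct sum of a module in `add V` and a module in `D`. -/
def Decomp (V : FGMod S) (D : Set (FGMod S)) (M : FGMod S) : Prop :=
  ∃ V' ∈ addOf {V}, ∃ D' ∈ D, Iso M (prodMod V' D')

lemma Decomp.syz_iterate {V M : FGMod S} {D : Set (FGMod S)} (hD : ∀ N ∈ D, syz N ∈ D)
    (h : Decomp V D M) (j : ℕ) : Decomp (syz^[j] V) D (syz^[j] M) := by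
  induction j with
  | zero => exact h
  | succ j ih =>
    obtain ⟨V', hV', D', hD', e⟩ := ih
    rw [Function.iterate_succ_apply', Function.iterate_succ_apply']
    exact ⟨syz V', addOf_syz hV', syz D', hD _ hD', e.syz.trans (syz_prod _ _)⟩

end Syzygy

/-! ### Indecomposable modules and multiplicities -/

section Multiplicity

variable {S : Type u} [Ring S]

/-- Indecomposability of a module. -/
def IsIndec (N : FGMod S) : Prop :=
  Nontrivial N.carrier ∧ ∀ M M' : FGMod S, Iso N (prodMod M M') →
    Subsingleton M.carrier ∨ Subsingleton M'.carrier

variable [IsArtinianRing S]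

/-- Fitting's lemma for indecomposable modules. -/
lemma IsIndec.bijective_or_isNilpotent {N : FGMod S} (hN : IsIndec N)
    (f : Module.End S N.carrier) : Bijective f ∨ IsNilpotent f := by
  obtain ⟨k, hk, hk1⟩ := (f.eventually_isCompl_ker_pow_range_pow.and
    (Filter.eventually_ge_atTop 1)).exists
  obtain ⟨j, rfl⟩ : ∃ j, k = j + 1 := ⟨k - 1, by omega⟩
  rcases hN.2 ⟨LinearMap.ker (f ^ (j + 1))⟩ ⟨LinearMap.range (f ^ (j + 1))⟩
    ⟨(Submodule.prodEquivOfIsCompl _ _ hk).symm⟩ with h | h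
  · left
    apply IsArtinian.bijective_of_injective_endomorphism
    rw [← LinearMap.ker_eq_bot, ← le_bot_iff,
      ← (Submodule.subsingleton_iff_eq_bot.1 h : LinearMap.ker (f ^ (j + 1)) = ⊥)]
    intro x hx
    rw [LinearMap.mem_ker, pow_succ, Module.End.mul_apply, LinearMap.mem_ker.1 hx, map_zero]
  · right
    exact ⟨j + 1, LinearMap.range_eq_bot.1 (Submodule.subsingleton_iff_eq_bot.1 h)⟩

/-- The endomorphism ring of an indecomposable module is local. -/
lemma IsIndec.bijective_of_add {N : FGMod S} (hN : IsIndec N) {f g : Module.End S N.carrier}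
    (h : Bijective (f + g)) : Bijective f ∨ Bijective g := by
  have : Nontrivial N.carrier := hN.1
  let e := LinearEquiv.ofBijective (f + g) h
  let u : Module.End S N.carrier := e.symm.toLinearMap
  have hu : u * f + u * g = 1 := by
    rw [← mul_add]
    ext x
    exact e.symm_apply_apply x
  have hcancel : ∀ a : Module.End S N.carrier, Bijective (u * a) → Bijective a := fun a ha =>
    (Bijective.of_comp_iff' (f := u) e.symm.bijective a).1 ha
  rcases hN.bijective_or_isNilpotent (u * f) with h1 | h1
  · exact Or.inl (hcancel f h1)
  rcases hN.bijective_or_isNilpotent (u * g) with h2 | h2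
  · exact Or.inr (hcancel g h2)
  rw [← eq_sub_iff_add_eq'] at hu
  rw [hu] at h2
  exact absurd h1.isUnit_one_sub h2.not_isUnit

/-- The homomorphisms `M → N` into an indecomposable module that are not split epimorphisms. -/
def radHom {N : FGMod S} (hN : IsIndec N) (M : FGMod S) :
    Submodule (Module.End S N.carrier) (M.carrier →ₗ[S] N.carrier) where
  carrier := {f | ∀ g : N.carrier →ₗ[S] M.carrier, ¬ Bijective (f ∘ₗ g)}
  zero_mem' g h := by
    have := hN.1
    obtain ⟨x, hx⟩ := exists_ne (0 : N.carrier)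
    exact hx (h.1 (by simp))
  add_mem' {f f'} hf hf' g h := by
    rw [LinearMap.add_comp] at h
    exact (hN.bijective_of_add h).elim (hf g) (hf' g)
  smul_mem' e f hf g h :=
    hf g (IsArtinian.bijective_of_injective_endomorphism _ (Injective.of_comp (f := e) h.1))

lemma radHom_eq_top {N M : FGMod S} (hN : IsIndec N) (h : ¬ IsSummand N M) :
    radHom hN M = ⊤ := by
  rw [eq_top_iff]
  intro f _ g hfg
  apply h
  let e := LinearEquiv.ofBijective (f ∘ₗ g) hfg
  let r : M.carrier →ₗ[S] LinearMap.ker f :=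
    LinearMap.codRestrict _ (LinearMap.id - g ∘ₗ e.symm.toLinearMap ∘ₗ f) fun x => by
      have : f (g (e.symm (f x))) = f x := e.apply_symm_apply (f x)
      simp [this]
  have he : ∀ x, f (g (e.symm x)) = x := e.apply_symm_apply
  have hr : ∀ x, (r x : M.carrier) = x - g (e.symm (f x)) := fun _ => rfl
  refine ⟨⟨LinearMap.ker f⟩, ⟨LinearEquiv.ofBijective (f.prod r) ⟨fun x y hxy => ?_, fun y => ?_⟩⟩⟩
  · have h1 : f x = f y := congrArg Prod.fst hxy
    have h2 : x - g (e.symm (f x)) = y - g (e.symm (f y)) :=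
      congrArg Subtype.val (congrArg Prod.snd hxy)
    rw [h1] at h2
    exact sub_left_injective h2
  · obtain ⟨a, ⟨b, hb⟩⟩ := y
    have hb' : f b = 0 := hb
    refine ⟨g (e.symm a) + b, Prod.ext ?_ (Subtype.ext ?_)⟩
    · simp [he, hb']
    · simp [hr, he, hb']

lemma radHom_self_ne_top {N : FGMod S} (hN : IsIndec N) : radHom hN N ≠ ⊤ := by
  intro h
  have hid : LinearMap.id ∈ radHom hN N := h ▸ Submodule.mem_top
  exact hid LinearMap.id bijective_id

/-- The multiplicity (up to the factor given by length) of an indecomposable module `N` as a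
direct summand of `M`. -/
noncomputable def mult {N : FGMod S} (hN : IsIndec N) (M : FGMod S) : ℕ∞ :=
  Module.length (Module.End S N.carrier) ((M.carrier →ₗ[S] N.carrier) ⧸ radHom hN M)

lemma mult_eq_zero {N M : FGMod S} (hN : IsIndec N) (h : ¬ IsSummand N M) : mult hN M = 0 := by
  rw [mult, Module.length_eq_zero_iff, Submodule.Quotient.subsingleton_iff]
  exact radHom_eq_top hN h

lemma mult_self_ne_zero {N : FGMod S} (hN : IsIndec N) : mult hN N ≠ 0 := by
  rw [mult, Ne, Module.length_eq_zero_iff, Submodule.Quotient.subsingleton_iff]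
  exact radHom_self_ne_top hN

lemma mult_add {N M M' M'' : FGMod S} (hN : IsIndec N)
    (e : M.carrier ≃ₗ[S] M'.carrier × M''.carrier) :
    mult hN M = mult hN M' + mult hN M'' := by
  let E := Module.End S N.carrier
  let i' : M'.carrier →ₗ[S] M.carrier := e.symm.toLinearMap ∘ₗ LinearMap.inl S _ _
  let i'' : M''.carrier →ₗ[S] M.carrier := e.symm.toLinearMap ∘ₗ LinearMap.inr S _ _
  let p' : M.carrier →ₗ[S] M'.carrier := LinearMap.fst S _ _ ∘ₗ e.toLinearMap
  let p'' : M.carrier →ₗ[S] M''.carrier := LinearMap.snd S _ _ ∘ₗ e.toLinearMap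
  have hsum : ∀ x, i' (p' x) + i'' (p'' x) = x := fun x => by
    simp [i', i'', p', p'', ← map_add]
  let t : (M.carrier →ₗ[S] N.carrier) →ₗ[E]
      ((M'.carrier →ₗ[S] N.carrier) ⧸ radHom hN M') ×
      ((M''.carrier →ₗ[S] N.carrier) ⧸ radHom hN M'') :=
    ((radHom hN M').mkQ ∘ₗ LinearMap.lcomp E N.carrier i').prod
      ((radHom hN M'').mkQ ∘ₗ LinearMap.lcomp E N.carrier i'')
  have ht : Surjective t := by
    rintro ⟨a, b⟩
    obtain ⟨f, rfl⟩ := Submodule.mkQ_surjective _ a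
    obtain ⟨g, rfl⟩ := Submodule.mkQ_surjective _ b
    have hf : (f ∘ₗ p' + g ∘ₗ p'') ∘ₗ i' = f := by ext x; simp [i', p', p'']
    have hg : (f ∘ₗ p' + g ∘ₗ p'') ∘ₗ i'' = g := by ext x; simp [i'', p', p'']
    exact ⟨f ∘ₗ p' + g ∘ₗ p'', Prod.ext (congrArg (radHom hN M').mkQ hf)
      (congrArg (radHom hN M'').mkQ hg)⟩
  have hker : LinearMap.ker t = radHom hN M := by
    ext f
    have hf : f ∈ LinearMap.ker t ↔ f ∘ₗ i' ∈ radHom hN M' ∧ f ∘ₗ i'' ∈ radHom hN M'' := by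
      rw [LinearMap.mem_ker, Prod.ext_iff]
      exact and_congr (Submodule.Quotient.mk_eq_zero _) (Submodule.Quotient.mk_eq_zero _)
    rw [hf]
    constructor
    · rintro ⟨h', h''⟩ g hg
      have hfg : f ∘ₗ g = (f ∘ₗ i') ∘ₗ (p' ∘ₗ g) + (f ∘ₗ i'') ∘ₗ (p'' ∘ₗ g) := by
        ext x
        simp only [LinearMap.comp_apply, LinearMap.add_apply, ← map_add, hsum]
      rw [hfg] at hg
      exact (hN.bijective_of_add hg).elim (h' _) (h'' _)
    · exact fun h => ⟨fun g => h (i' ∘ₗ g), fun g => h (i'' ∘ₗ g)⟩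
  rw [mult, mult, mult, ← Module.length_prod, ← hker]
  exact (t.quotKerEquivOfSurjective ht).length_eq

lemma mult_ne_top {N : FGMod S} (hN : IsIndec N) [IsArtinian (Module.End S N.carrier) N.carrier]
    [IsNoetherian (Module.End S N.carrier) N.carrier] (M : FGMod S) : mult hN M ≠ ⊤ := by
  obtain ⟨n, p, hp⟩ := Module.Finite.exists_fin' S M.carrier
  let t : (M.carrier →ₗ[S] N.carrier) →ₗ[Module.End S N.carrier] (Fin n → N.carrier) :=
    { toFun := fun f i => f (p (Pi.single i 1))
      map_add' := fun _ _ => rfl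
      map_smul' := fun _ _ => rfl }
  have ht : Injective t := by
    intro f g hfg
    have h : f ∘ₗ p = g ∘ₗ p := by
      refine (Pi.basisFun S (Fin n)).ext fun i => ?_
      have hi : f (p (Pi.single i 1)) = g (p (Pi.single i 1)) := congrFun hfg i
      simpa using hi
    ext x
    obtain ⟨y, rfl⟩ := hp x
    exact LinearMap.congr_fun h y
  have := isArtinian_of_injective t ht
  have := isNoetherian_of_injective t ht
  exact Module.length_ne_top

end Multiplicity

/-! ### Finitely generated subgroups of `K_D` -/

section Decomposition

variable {S : Type u} [Ring S]

/-- Over an Artin algebra, modules have finite length over their endomorphism rings. -/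
lemma finite_length_end {R : Type u} [CommRing R] [IsArtinianRing R] [Algebra R S]
    [Module.Finite R S] (N : FGMod S) :
    IsArtinian (Module.End S N.carrier) N.carrier ∧
      IsNoetherian (Module.End S N.carrier) N.carrier := by
  let : Module R N.carrier := Module.compHom N.carrier (algebraMap R S)
  have : IsScalarTower R S N.carrier :=
    ⟨fun r s x => by rw [Algebra.smul_def, mul_smul]; rfl⟩
  have : SMulCommClass S R N.carrier := IsScalarTower.to_smulCommClass'
  have : Module.Finite R N.carrier := Module.Finite.trans S N.carrier
  have : IsScalarTower R (Module.End S N.carrier) N.carrier := ⟨fun r f x => rfl⟩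
  exact ⟨isArtinian_of_tower R inferInstance, isNoetherian_of_tower R inferInstance⟩

/-- Every element of `K_D` is a combination of the classes of the direct summands of one module. -/
lemma exists_support {D : Set (FGMod S)} (x : KD D) : ∃ V : FGMod S, ∀ φ : KD D →+ ℤ,
    (∀ M, IsSummand M V → φ (toKD D M) = 0) → φ x = 0 := by
  obtain ⟨y, rfl⟩ := QuotientAddGroup.mk_surjective x
  obtain ⟨z, rfl⟩ := QuotientAddGroup.mk_surjective y
  induction z using FreeAbelianGroup.induction_on with
  | zero => exact ⟨zeroMod S, fun φ _ => map_zero φ⟩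
  | of M => exact ⟨M, fun φ h => h M (FGMod.IsSummand.refl M)⟩
  | neg M _ =>
    refine ⟨M, fun φ h => ?_⟩
    have := h M (FGMod.IsSummand.refl M)
    exact (map_neg φ (toKD D M)).trans (by rw [this, neg_zero])
  | add a b ha hb =>
    obtain ⟨V, hV⟩ := ha
    obtain ⟨W, hW⟩ := hb
    refine ⟨prodMod V W, fun φ h => ?_⟩
    refine (map_add φ (QuotientAddGroup.mk (QuotientAddGroup.mk a))
      (QuotientAddGroup.mk (QuotientAddGroup.mk b))).trans ?_
    rw [hV φ fun M hM => h M (hM.trans (isSummand_left V W)),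
      hW φ fun M hM => h M (hM.trans (isSummand_right V W)), add_zero]

lemma exists_support_of_fg {D : Set (FGMod S)} {H : AddSubgroup (KD D)} (hH : H.FG) :
    ∃ V : FGMod S, ∀ φ : KD D →+ ℤ, (∀ M, IsSummand M V → φ (toKD D M) = 0) →
      ∀ x ∈ H, φ x = 0 := by
  classical
  obtain ⟨s, rfl⟩ := hH
  have key : ∃ V : FGMod S, ∀ φ : KD D →+ ℤ, (∀ M, IsSummand M V → φ (toKD D M) = 0) →
      ∀ x ∈ s, φ x = 0 := by
    induction s using Finset.induction_on with
    | empty => exact ⟨zeroMod S, by simp⟩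
    | insert a s _ ih =>
      obtain ⟨V, hV⟩ := ih
      obtain ⟨W, hW⟩ := exists_support a
      refine ⟨prodMod V W, fun φ h x hx => ?_⟩
      rcases Finset.mem_insert.1 hx with rfl | hx
      · exact hW φ fun M hM => h M (hM.trans (isSummand_right V W))
      · exact hV φ (fun M hM => h M (hM.trans (isSummand_left V W))) x hx
  obtain ⟨V, hV⟩ := key
  exact ⟨V, fun φ h x hx => (AddSubgroup.closure_le φ.ker).2 (hV φ h) hx⟩

variable [IsArtinianRing S]

/-- The multiplicity of an indecomposable module that is neither projective nor in `D` descends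
to `K_D`. -/
lemma exists_multHom (hfin : ∀ N : FGMod S, IsArtinian (Module.End S N.carrier) N.carrier ∧
      IsNoetherian (Module.End S N.carrier) N.carrier)
    {D : Set (FGMod S)} (hD : D = addOf D) {N : FGMod S} (hN : IsIndec N) (hNp : ¬ N.IsProj)
    (hND : N ∉ D) : ∃ φ : KD D →+ ℤ, φ (toKD D N) ≠ 0 ∧
      ∀ M, ¬ IsSummand N M → φ (toKD D M) = 0 := by
  obtain ⟨_, _⟩ := hfin N
  let μ : FGMod S → ℤ := fun M => ((mult hN M).toNat : ℤ)
  have hμ0 : ∀ M, ¬ IsSummand N M → μ M = 0 := fun M h => by simp [μ, mult_eq_zero hN h]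
  let φ₁ : K0 S →+ ℤ := QuotientAddGroup.lift (K0Rels S) (FreeAbelianGroup.lift μ) (by
    rw [K0Rels, AddSubgroup.closure_le]
    rintro x (⟨M, M', M'', ⟨e⟩, rfl⟩ | ⟨P, hP, rfl⟩)
    · have : μ M = μ M' + μ M'' := by
        simp only [μ]
        rw [mult_add hN e, ENat.toNat_add (mult_ne_top hN _) (mult_ne_top hN _), Nat.cast_add]
      simp [this]
    · have : μ P = 0 := hμ0 P fun h => hNp (hP.of_isSummand h)
      simp [this])
  have hφ₁ : ∀ M, φ₁ (toK0 M) = μ M := fun M => FreeAbelianGroup.lift_apply_of μ M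
  let φ : KD D →+ ℤ := QuotientAddGroup.lift (grpOf D) φ₁ (by
    rw [grpOf, AddSubgroup.closure_le]
    rintro x ⟨K, M, hM, hK, rfl⟩
    refine (hφ₁ K).trans (hμ0 K fun h => hND ?_)
    rw [hD]
    exact addOf_summand (subset_addOf hM) (h.trans hK))
  have hφ : ∀ M, φ (toKD D M) = μ M := hφ₁
  refine ⟨φ, ?_, fun M hM => (hφ M).trans (hμ0 M hM)⟩
  rw [hφ]
  simp [μ, mult_self_ne_zero hN, mult_ne_top hN]

/-- A module all of whose indecomposable summands lie in `add V` or in `D` decomposes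
accordingly. -/
lemma decomp_of_forall_isIndec {V : FGMod S} {D : Set (FGMod S)} (hD : D = addOf D)
    (T : FGMod S) (hT : ∀ N, IsIndec N → IsSummand N T → N ∈ addOf {V} ∨ N ∈ D) :
    Decomp V D T := by
  have hDz : ∀ M : FGMod S, Subsingleton M.carrier → M ∈ D := fun M _ => by
    rw [hD]; exact subsingleton_mem_addOf M
  obtain ⟨n, hn⟩ : ∃ n : ℕ, Module.length S T.carrier = n :=
    ⟨_, (ENat.natCast_toNat Module.length_ne_top).symm⟩
  induction n using Nat.strong_induction_on generalizing T with
  | _ n ih =>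
  by_cases hind : IsIndec T
  · rcases hT T hind (FGMod.IsSummand.refl T) with h | h
    · exact ⟨T, h, zeroMod S, hDz _ inferInstance, Iso.prod_subsingleton _ _⟩
    · exact ⟨zeroMod S, subsingleton_mem_addOf _, T, h,
        (Iso.prod_subsingleton T (zeroMod S)).trans (Iso.prodComm _ _)⟩
  by_cases hz : Subsingleton T.carrier
  · exact ⟨T, subsingleton_mem_addOf _, zeroMod S, hDz _ inferInstance,
      Iso.prod_subsingleton _ _⟩
  rw [not_subsingleton_iff_nontrivial] at hz
  obtain ⟨M, M', ⟨e⟩, hM, hM'⟩ : ∃ M M' : FGMod S, Iso T (prodMod M M') ∧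
      Nontrivial M.carrier ∧ Nontrivial M'.carrier := by
    by_contra! hcon
    refine hind ⟨hz, fun M M' h => ?_⟩
    by_contra! h'
    exact not_nontrivial_iff_subsingleton.2 (hcon M M' h h'.1) h'.2
  obtain ⟨a, ha⟩ : ∃ n : ℕ, Module.length S M.carrier = n :=
    ⟨_, (ENat.natCast_toNat Module.length_ne_top).symm⟩
  obtain ⟨b, hb⟩ : ∃ n : ℕ, Module.length S M'.carrier = n :=
    ⟨_, (ENat.natCast_toNat Module.length_ne_top).symm⟩
  have hlen : n = a + b := by
    have := e.length_eq.trans (Module.length_prod S M.carrier M'.carrier)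
    rw [hn, ha, hb] at this
    exact_mod_cast this
  have ha0 : 0 < a := by
    have := Module.length_pos (R := S) (M := M.carrier)
    rw [ha] at this
    exact_mod_cast this
  have hb0 : 0 < b := by
    have := Module.length_pos (R := S) (M := M'.carrier)
    rw [hb] at this
    exact_mod_cast this
  obtain ⟨V₁, hV₁, D₁, hD₁, e₁⟩ := ih a (by omega) M (fun N hN h =>
    hT N hN (h.trans ((isSummand_left M M').trans (Iso.isSummand ⟨e⟩)))) ha
  obtain ⟨V₂, hV₂, D₂, hD₂, e₂⟩ := ih b (by omega) M' (fun N hN h =>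
    hT N hN (h.trans ((isSummand_right M M').trans (Iso.isSummand ⟨e⟩)))) hb
  refine ⟨prodMod V₁ V₂, addOf_prod hV₁ hV₂, prodMod D₁ D₂, ?_,
    Iso.trans ⟨e⟩ ((e₁.prod e₂).trans (Iso.prodProdProdComm _ _ _ _))⟩
  rw [hD] at hD₁ hD₂ ⊢
  exact addOf_prod hD₁ hD₂

lemma exists_decomp_of_fg (hfin : ∀ N : FGMod S, IsArtinian (Module.End S N.carrier) N.carrier ∧
      IsNoetherian (Module.End S N.carrier) N.carrier)
    {D : Set (FGMod S)} (hD : D = addOf D) {C : Set (FGMod S)} (hC : (classGrpD D C).FG) :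
    ∃ V : FGMod S, ∀ T ∈ C, Decomp V D T := by
  obtain ⟨V, hV⟩ := exists_support_of_fg hC
  refine ⟨prodMod V (regular S), fun T hT => decomp_of_forall_isIndec hD T fun N hN hNT => ?_⟩
  by_contra! hcon
  obtain ⟨φ, hφN, hφ⟩ := exists_multHom hfin hD hN (fun hP => hcon.1
    (addOf_singleton_mono (isSummand_right _ _) hP.mem_addOf)) hcon.2
  refine hφN (hV φ (fun M hM => hφ M fun h => hcon.1 ?_) _ ?_)
  · exact addOf_singleton_mono (isSummand_left _ _)
      (addOf_summand (subset_addOf rfl) (h.trans hM))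
  · exact AddSubgroup.mem_map_of_mem _ (AddSubgroup.subset_closure ⟨N, T, hT, hNT, rfl⟩)

/-- The iterated syzygies of a `D`-syzygy finite class eventually decompose. -/
lemma DSyzFinite.exists_decomp
    (hfin : ∀ N : FGMod S, IsArtinian (Module.End S N.carrier) N.carrier ∧
      IsNoetherian (Module.End S N.carrier) N.carrier)
    {D : Set (FGMod S)} (hD : D = addOf D) (hDs : ∀ M ∈ D, syz M ∈ D) {C : Set (FGMod S)}
    (hC : DSyzFinite D C) :
    ∃ k : ℕ, ∀ m, k ≤ m → ∃ V : FGMod S, ∀ M ∈ C, Decomp V D (syz^[m] M) := by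
  obtain ⟨k, hk⟩ := hC
  obtain ⟨V, hV⟩ := exists_decomp_of_fg hfin hD hk
  refine ⟨k, fun m hm => ⟨syz^[m - k] V, fun M hM => ?_⟩⟩
  have := (hV _ ⟨M, hM, rfl⟩).syz_iterate hDs (m - k)
  rwa [← Function.iterate_add_apply, Nat.sub_add_cancel hm] at this

end Decomposition

/-!
STATEMENT 11 (Proposition).  Let `D` be a `0`-Igusa-Todorov subcategory and
`C₁, C₂` two `D`-syzygy finite subcategories.  If `E` is a subcategory such that
every `M ∈ E` sits in a short exact sequence `0 → C₁ → M → C₂ → 0` with `Cᵢ ∈ Cᵢ`,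
then `E` is `(n, V, D)`-LIT for some positive integer `n` and some module `V`.
-/
theorem stmt_11 (R A : Type u) [CommRing R] [IsArtinianRing R] [Ring A] [Algebra R A]
    [Module.Finite R A]
    (L : AddMonoid.End (K0 Aᵐᵒᵖ)) (hL : IsSyzEnd L)
    (D : Set (FGMod Aᵐᵒᵖ)) (hD : IsZeroIT L D)
    (C1 C2 : Set (FGMod Aᵐᵒᵖ)) (h1 : DSyzFinite D C1) (h2 : DSyzFinite D C2)
    (E : Set (FGMod Aᵐᵒᵖ))
    (hses : ∀ M ∈ E, ∃ X ∈ C1, ∃ Y ∈ C2, SES X M Y) :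
    ∃ n : ℕ, 0 < n ∧ ∃ V : FGMod Aᵐᵒᵖ, IsLITClass n V D E := by
  have hart : IsArtinianRing Aᵐᵒᵖ := IsArtinianRing.of_finite R Aᵐᵒᵖ
  have hfin := finite_length_end (R := R) (S := Aᵐᵒᵖ)
  obtain ⟨hDadd, hDs, -⟩ := hD
  obtain ⟨k₁, hk₁⟩ := h1.exists_decomp hfin hDadd hDs
  obtain ⟨k₂, hk₂⟩ := h2.exists_decomp hfin hDadd hDs
  obtain ⟨V₁, hV₁⟩ := hk₁ (k₁ + k₂ + 1) (by omega)
  obtain ⟨V₂, hV₂⟩ := hk₂ (k₁ + k₂ + 1 + 1) (by omega)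
  refine ⟨k₁ + k₂ + 1, by omega, prodMod (prodMod V₁ V₂) (regular Aᵐᵒᵖ), fun M hM => ?_⟩
  obtain ⟨X, hX, Y, hY, hXMY⟩ := hses M hM
  obtain ⟨Q, hQ, hs⟩ := ses_syz_iterate hXMY (k₁ + k₂ + 1)
  obtain ⟨V0, hV0, D0, hD0, e0⟩ := hV₁ X hX
  obtain ⟨V1, hV1, D1, hD1, e1⟩ := hV₂ Y hY
  have hl : IsSummand (prodMod V₁ V₂) (prodMod (prodMod V₁ V₂) (regular Aᵐᵒᵖ)) :=
    isSummand_left _ _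
  refine ⟨V1, prodMod V0 Q, D1, D0,
    addOf_singleton_mono ((isSummand_right _ _).trans hl) hV1,
    addOf_prod (addOf_singleton_mono ((isSummand_left _ _).trans hl) hV0)
      (addOf_singleton_mono (isSummand_right _ _) hQ.mem_addOf), hD1, hD0, ?_⟩
  refine hs.congr e1 ?_ (Iso.refl _)
  exact (e0.prod (Iso.refl Q)).trans ((Iso.prodAssoc _ _ _).trans
    (((Iso.refl V0).prod (Iso.prodComm _ _)).trans (Iso.prodAssoc _ _ _).symm))
end LIT
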